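/- arXiv:2305.16327 — 5 statements merged into one kernel-verified Lean document; each statement's English description precedes it below -/
import Mathlib

section
/- For all X, Y, Z ∈ 𝔤 the following identities hold: (1) g̃(∇̃_{X^c}Y^c, Z^c) = ⟨∇¹_X Y, Z⟩₁; (2) g̃(∇̃_{X^c}Y^c, Z^v) = g̃(∇̃_{X^c}Y^v, Z^c) = g̃(∇̃_{X^v}Y^c, Z^c) = g̃(∇̃_{X^v}Y^v, Z^v) = 0; (3) g̃(∇̃_{X^c}Y^v, Z^v) = ½(⟨Y,[Z,X]⟩₂ + ⟨Z,[X,Y]⟩₂); (4) g̃(∇̃_{X^v}Y^c, Z^v) = ½(⟨Z,[X,Y]⟩₂ − ⟨X,[Y,Z]⟩₂); (5) g̃(∇̃_{X^v}Y^v, Z^c) = ½(⟨Y,[Z,X]⟩₂ − ⟨X,[Y,Z]⟩₂). -/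
/-- `g` is an inner product (symmetric positive-definite bilinear form) on a real vector space. -/
structure IsInnerProd {L : Type*} [AddCommGroup L] [Module ℝ L] (g : L → L → ℝ) : Prop where
  addLeft : ∀ x y z : L, g (x + y) z = g x z + g y z
  smulLeft : ∀ (a : ℝ) (x y : L), g (a • x) y = a * g x y
  symm : ∀ x y : L, g x y = g y x
  posDef : ∀ x : L, x ≠ 0 → 0 < g x x

/-- The bracket of the tangent Lie algebra `T𝔤 = 𝔤 × 𝔤`:
`[(X₁,Y₁),(X₂,Y₂)] = ([X₁,X₂], [X₁,Y₂] + [Y₁,X₂])`.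
The complete lift of `X` is `(X, 0)` and the vertical lift is `(0, X)`. -/
def tbr {L : Type*} [LieRing L] (A B : L × L) : L × L :=
  (⁅A.1, B.1⁆, ⁅A.1, B.2⁆ + ⁅A.2, B.1⁆)

/-- The lifted inner product `g̃` on `T𝔤 = 𝔤 × 𝔤` determined by
`g̃(X^c,Y^c) = ⟨X,Y⟩₁`, `g̃(X^v,Y^v) = ⟨X,Y⟩₂`, `g̃(X^c,Y^v) = 0`. -/
def tg {L : Type*} (g1 g2 : L → L → ℝ) (A B : L × L) : ℝ :=
  g1 A.1 B.1 + g2 A.2 B.2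

/-- `nab` is the Levi-Civita connection of the metric `g` with respect to the bracket `br`,
i.e. it satisfies the Koszul formula
`2⟨∇_X Y, Z⟩ = ⟨[X,Y],Z⟩ − ⟨[Y,Z],X⟩ + ⟨[Z,X],Y⟩`. -/
def IsLC {V : Type*} [AddCommGroup V] [Module ℝ V] (br : V → V → V)
    (g : V → V → ℝ) (nab : V → V → V) : Prop :=
  ∀ X Y Z : V, 2 * g (nab X Y) Z = g (br X Y) Z - g (br Y Z) X + g (br Z X) Y

/-- The curvature tensor `R(X,Y)Z = ∇_X ∇_Y Z − ∇_Y ∇_X Z − ∇_{[X,Y]} Z`. -/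
def curvOf {V : Type*} [AddCommGroup V] (br nab : V → V → V) (X Y Z : V) : V :=
  nab X (nab Y Z) - nab Y (nab X Z) - nab (br X Y) Z

namespace IsInnerProd

variable {L : Type*} [AddCommGroup L] [Module ℝ L] {g : L → L → ℝ}

theorem zero_left (hg : IsInnerProd g) (x : L) : g 0 x = 0 := by
  have h := hg.addLeft 0 0 x
  rw [add_zero] at h
  linarith

theorem zero_right (hg : IsInnerProd g) (x : L) : g x 0 = 0 := by
  rw [hg.symm, hg.zero_left]

end IsInnerProd

theorem statement1 {L : Type*} [LieRing L] [Module ℝ L] [LieAlgebra ℝ L]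
    [FiniteDimensional ℝ L]
    (g1 g2 : L → L → ℝ) (hg1 : IsInnerProd g1) (hg2 : IsInnerProd g2)
    (nabla1 nabla2 : L → L → L)
    (hn1 : IsLC (fun X Y : L => ⁅X, Y⁆) g1 nabla1)
    (hn2 : IsLC (fun X Y : L => ⁅X, Y⁆) g2 nabla2)
    (tnabla : L × L → L × L → L × L)
    (htn : IsLC tbr (tg g1 g2) tnabla) :
    ∀ X Y Z : L,
      (tg g1 g2 (tnabla (X, 0) (Y, 0)) (Z, 0) = g1 (nabla1 X Y) Z) ∧
      (tg g1 g2 (tnabla (X, 0) (Y, 0)) (0, Z) = 0) ∧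
      (tg g1 g2 (tnabla (X, 0) (0, Y)) (Z, 0) = 0) ∧
      (tg g1 g2 (tnabla (0, X) (Y, 0)) (Z, 0) = 0) ∧
      (tg g1 g2 (tnabla (0, X) (0, Y)) (0, Z) = 0) ∧
      (tg g1 g2 (tnabla (X, 0) (0, Y)) (0, Z) = (1 / 2) * (g2 Y ⁅Z, X⁆ + g2 Z ⁅X, Y⁆)) ∧
      (tg g1 g2 (tnabla (0, X) (Y, 0)) (0, Z) = (1 / 2) * (g2 Z ⁅X, Y⁆ - g2 X ⁅Y, Z⁆)) ∧
      (tg g1 g2 (tnabla (0, X) (0, Y)) (Z, 0) = (1 / 2) * (g2 Y ⁅Z, X⁆ - g2 X ⁅Y, Z⁆)) := by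
  intro X Y Z
  have koszul (A B C : L × L) : tg g1 g2 (tnabla A B) C =
      (1 / 2) * (tg g1 g2 (tbr A B) C - tg g1 g2 (tbr B C) A + tg g1 g2 (tbr C A) B) := by
    linarith [htn A B C]
  refine ⟨?_, ?_, ?_, ?_, ?_, ?_, ?_, ?_⟩
  · rw [koszul]
    simp only [tg, tbr, lie_zero, zero_lie, add_zero, hg2.zero_left]
    linarith [hn1 X Y Z]
  all_goals
    rw [koszul]
    simp [tg, tbr, hg1.zero_left, hg1.zero_right, hg2.zero_left, hg2.zero_right]
  · rw [hg2.symm ⁅X, Y⁆, hg2.symm ⁅Z, X⁆, add_comm]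
  · rw [hg2.symm ⁅X, Y⁆, hg2.symm ⁅Y, Z⁆]
  · rw [hg2.symm ⁅Z, X⁆, hg2.symm ⁅Y, Z⁆]
    ring
end

section
/- For all X, Y ∈ 𝔤 one has ∇̃_{X^c}Y^v = (∇²_X Y + ½(ad₂ Y)*X)^v. -/
theorem IsInnerProd.zero_left_s3 {L : Type*} [AddCommGroup L] [Module ℝ L] {g : L → L → ℝ}
    (hg : IsInnerProd g) (x : L) : g 0 x = 0 := by
  simpa using hg.addLeft 0 0 x

theorem IsInnerProd.zero_right_s3 {L : Type*} [AddCommGroup L] [Module ℝ L] {g : L → L → ℝ}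
    (hg : IsInnerProd g) (x : L) : g x 0 = 0 := by
  rw [hg.symm, hg.zero_left_s3]

theorem IsInnerProd.ext_left {L : Type*} [AddCommGroup L] [Module ℝ L] {g : L → L → ℝ}
    (hg : IsInnerProd g) {a b : L} (h : ∀ z, g a z = g b z) : a = b := by
  by_contra hab
  have hpos := hg.posDef (a - b) (sub_ne_zero.mpr hab)
  have hadd := hg.addLeft (a - b) b (a - b)
  rw [sub_add_cancel] at hadd
  linarith [h (a - b)]

theorem statement3 {L : Type*} [LieRing L] [Module ℝ L] [LieAlgebra ℝ L]
    [FiniteDimensional ℝ L]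
    (g1 g2 : L → L → ℝ) (hg1 : IsInnerProd g1) (hg2 : IsInnerProd g2)
    (nabla1 nabla2 : L → L → L)
    (hn1 : IsLC (fun X Y : L => ⁅X, Y⁆) g1 nabla1)
    (hn2 : IsLC (fun X Y : L => ⁅X, Y⁆) g2 nabla2)
    (tnabla : L × L → L × L → L × L)
    (htn : IsLC tbr (tg g1 g2) tnabla)
    (ads : L → L → L)
    (hads : ∀ X Y Z : L, g2 (ads X Y) Z = g2 Y ⁅X, Z⁆) :
    ∀ X Y : L, tnabla (X, 0) (0, Y) = ((0 : L), nabla2 X Y + ((1 : ℝ) / 2) • ads Y X) := by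
  intro X Y
  refine Prod.ext (hg1.ext_left fun Z => ?_) (hg2.ext_left fun Z => ?_)
  · have h := htn (X, 0) (0, Y) (Z, 0)
    simp only [tbr, tg, lie_zero, zero_lie, add_zero, zero_add, hg1.zero_left_s3, hg1.zero_right_s3,
      hg2.zero_left_s3, hg2.zero_right_s3] at h
    rw [hg1.zero_left_s3]
    linarith
  · have h := htn (X, 0) (0, Y) (0, Z)
    simp only [tbr, tg, lie_zero, zero_lie, add_zero, zero_add, hg1.zero_left_s3, hg1.zero_right_s3,
      hg2.zero_left_s3] at h
    have h2 := hn2 X Y Z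
    simp only at h2
    rw [hg2.addLeft, hg2.smulLeft, hads, hg2.symm X]
    linarith
end

section
/- Let X ∈ 𝔤 and ρ ∈ ℝ. Then X is a conformal vector field with factor ρ with respect to both ⟨·,·⟩₁ and ⟨·,·⟩₂ (i.e. ⟨[X,Y],Z⟩ᵢ + ⟨Y,[X,Z]⟩ᵢ = −2ρ⟨Y,Z⟩ᵢ for all Y,Z ∈ 𝔤 and i = 1,2) if and only if X^c is a conformal vector field with factor ρ with respect to g̃ on T𝔤 (i.e. g̃([X^c,Ã],B̃) + g̃(Ã,[X^c,B̃]) = −2ρ g̃(Ã,B̃) for all Ã,B̃ ∈ T𝔤). -/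
theorem statement9 {L : Type*} [LieRing L] [Module ℝ L] [LieAlgebra ℝ L]
    [FiniteDimensional ℝ L]
    (g1 g2 : L → L → ℝ) (hg1 : IsInnerProd g1) (hg2 : IsInnerProd g2)
    (X : L) (ρ : ℝ) :
    ((∀ Y Z : L, g1 ⁅X, Y⁆ Z + g1 Y ⁅X, Z⁆ = -2 * ρ * g1 Y Z) ∧
     (∀ Y Z : L, g2 ⁅X, Y⁆ Z + g2 Y ⁅X, Z⁆ = -2 * ρ * g2 Y Z)) ↔
    (∀ A B : L × L,
      tg g1 g2 (tbr (X, 0) A) B + tg g1 g2 A (tbr (X, 0) B) = -2 * ρ * tg g1 g2 A B) := by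
  have zeroLeft {g : L → L → ℝ} (hg : IsInnerProd g) (y : L) : g 0 y = 0 := by
    simpa using hg.addLeft 0 0 y
  simp only [tbr, tg, zero_lie, add_zero]
  constructor
  · rintro ⟨h1, h2⟩ A B
    linear_combination h1 A.1 B.1 + h2 A.2 B.2
  · intro h
    refine ⟨fun Y Z => ?_, fun Y Z => ?_⟩
    · simpa [zeroLeft hg2] using h (Y, 0) (Z, 0)
    · simpa [zeroLeft hg1] using h (0, Y) (0, Z)
end

section
/- For all X, Y, Z ∈ 𝔤 one has R̃(X^c, Y^c)Z^c = (R¹(X,Y)Z)^c. -/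
namespace IsInnerProd

variable {L : Type*} [AddCommGroup L] [Module ℝ L] {g : L → L → ℝ}

theorem sub_left (hg : IsInnerProd g) (x y z : L) : g (x - y) z = g x z - g y z := by
  have h := hg.addLeft (x - y) y z
  rw [sub_add_cancel] at h
  linarith

theorem ext_left_s12 (hg : IsInnerProd g) {x y : L} (h : ∀ z, g x z = g y z) : x = y := by
  by_contra hne
  have hpos := hg.posDef (x - y) (sub_ne_zero.mpr hne)
  rw [hg.sub_left, h, sub_self] at hpos
  exact lt_irrefl _ hpos

end IsInnerProd

/-- The connection of the lifted metric on complete lifts is the complete lift of the connection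
of the first metric. -/
theorem IsLC.tangent_complete_complete {L : Type*} [LieRing L] [Module ℝ L]
    {g1 g2 : L → L → ℝ} (hg1 : IsInnerProd g1) (hg2 : IsInnerProd g2)
    {nabla1 : L → L → L} (hn1 : IsLC (fun X Y : L => ⁅X, Y⁆) g1 nabla1)
    {tnabla : L × L → L × L → L × L} (htn : IsLC tbr (tg g1 g2) tnabla) (X Y : L) :
    tnabla (X, 0) (Y, 0) = (nabla1 X Y, 0) := by
  refine Prod.ext (hg1.ext_left_s12 fun Z => ?_) (hg2.ext_left_s12 fun Z => ?_)
  · have h := htn (X, 0) (Y, 0) (Z, 0)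
    have h1 := hn1 X Y Z
    simp only [tg, tbr, hg2.zero_right, lie_zero, zero_lie, add_zero] at h
    linarith
  · have h := htn (X, 0) (Y, 0) (0, Z)
    simp only [tg, tbr, hg1.zero_right, hg1.zero_left, hg2.zero_right, hg2.zero_left, lie_zero,
      zero_lie, add_zero, zero_add, sub_zero] at h
    rw [hg2.zero_left]
    linarith

theorem statement12 {L : Type*} [LieRing L] [Module ℝ L] [LieAlgebra ℝ L]
    [FiniteDimensional ℝ L]
    (g1 g2 : L → L → ℝ) (hg1 : IsInnerProd g1) (hg2 : IsInnerProd g2)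
    (nabla1 nabla2 : L → L → L)
    (hn1 : IsLC (fun X Y : L => ⁅X, Y⁆) g1 nabla1)
    (hn2 : IsLC (fun X Y : L => ⁅X, Y⁆) g2 nabla2)
    (tnabla : L × L → L × L → L × L)
    (htn : IsLC tbr (tg g1 g2) tnabla) :
    ∀ X Y Z : L,
      curvOf tbr tnabla (X, 0) (Y, 0) (Z, 0)
        = (curvOf (fun X Y : L => ⁅X, Y⁆) nabla1 X Y Z, (0 : L)) := by
  intro X Y Z
  have key := IsLC.tangent_complete_complete hg1 hg2 hn1 htn
  have hbr : tbr ((X, 0) : L × L) (Y, 0) = (⁅X, Y⁆, 0) := by simp [tbr]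
  simp only [curvOf, hbr, key, Prod.mk_sub_mk, sub_zero]
end

section
/- Let ω₁ and ω₂ be two symplectic forms on 𝔤, and define the bilinear form ω̃ on T𝔤 by ω̃(X^c, Y^c) = ω₁(X,Y), ω̃(X^c, Y^v) = ω₂(X,Y), ω̃(X^v, Y^c) = −ω₂(Y,X) and ω̃(X^v, Y^v) = 0 for all X, Y ∈ 𝔤. Then ω̃ is a symplectic form on the tangent Lie algebra T𝔤: it is alternating, nondegenerate, and satisfies the cocycle identity ω̃([Ã,B̃],C̃) + ω̃([B̃,C̃],Ã) + ω̃([C̃,Ã],B̃) = 0 for all Ã, B̃, C̃ ∈ T𝔤. -/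
/-- A symplectic form on a Lie algebra (with bracket `br`): an alternating bilinear form that
is nondegenerate and satisfies the cocycle identity
`ω([A,B],C) + ω([B,C],A) + ω([C,A],B) = 0`. -/
structure IsSymplecticForm {V : Type*} [AddCommGroup V] [Module ℝ V]
    (br : V → V → V) (w : V → V → ℝ) : Prop where
  addLeft : ∀ x y z : V, w (x + y) z = w x z + w y z
  smulLeft : ∀ (a : ℝ) (x y : V), w (a • x) y = a * w x y
  addRight : ∀ x y z : V, w x (y + z) = w x y + w x z
  smulRight : ∀ (a : ℝ) (x y : V), w x (a • y) = a * w x y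
  alt : ∀ x : V, w x x = 0
  nondeg : ∀ x : V, (∀ y : V, w x y = 0) → x = 0
  cocycle : ∀ x y z : V, w (br x y) z + w (br y z) x + w (br z x) y = 0

/-- The lifted 2-form `ω̃` on `T𝔤 = 𝔤 × 𝔤` determined by `ω̃(X^c,Y^c) = ω₁(X,Y)`,
`ω̃(X^c,Y^v) = ω₂(X,Y)`, `ω̃(X^v,Y^c) = −ω₂(Y,X)` and `ω̃(X^v,Y^v) = 0`. -/
def tomega {L : Type*} (w1 w2 : L → L → ℝ) (A B : L × L) : ℝ :=
  w1 A.1 B.1 + w2 A.1 B.2 - w2 B.1 A.2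

theorem IsSymplecticForm.neg_swap {V : Type*} [AddCommGroup V] [Module ℝ V]
    {br : V → V → V} {w : V → V → ℝ} (hw : IsSymplecticForm br w) (x y : V) :
    w x y = -w y x := by
  have h := hw.alt (x + y)
  rw [hw.addLeft, hw.addRight, hw.addRight, hw.alt, hw.alt] at h
  linarith

theorem IsSymplecticForm.zero_left {V : Type*} [AddCommGroup V] [Module ℝ V]
    {br : V → V → V} {w : V → V → ℝ} (hw : IsSymplecticForm br w) (y : V) :
    w 0 y = 0 := by
  simpa using hw.smulLeft 0 0 y

theorem IsSymplecticForm.zero_right {V : Type*} [AddCommGroup V] [Module ℝ V]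
    {br : V → V → V} {w : V → V → ℝ} (hw : IsSymplecticForm br w) (x : V) :
    w x 0 = 0 := by
  simpa using hw.smulRight 0 x 0

/-- If `ω₁` and `ω₂` are symplectic forms on `𝔤`, then the lifted form `ω̃` is a symplectic
form on the tangent Lie algebra `T𝔤`. -/
theorem statement19 {L : Type*} [LieRing L] [Module ℝ L] [LieAlgebra ℝ L]
    [FiniteDimensional ℝ L]
    (w1 w2 : L → L → ℝ)
    (hw1 : IsSymplecticForm (fun X Y : L => ⁅X, Y⁆) w1)
    (hw2 : IsSymplecticForm (fun X Y : L => ⁅X, Y⁆) w2)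
    :
    IsSymplecticForm tbr (tomega w1 w2) := by
  constructor
  · intro x y z
    simp only [tomega, Prod.fst_add, Prod.snd_add, hw1.addLeft, hw2.addLeft, hw2.addRight]
    ring
  · intro a x y
    simp only [tomega, Prod.smul_fst, Prod.smul_snd, hw1.smulLeft, hw2.smulLeft, hw2.smulRight]
    ring
  · intro x y z
    simp only [tomega, Prod.fst_add, Prod.snd_add, hw1.addRight, hw2.addLeft, hw2.addRight]
    ring
  · intro a x y
    simp only [tomega, Prod.smul_fst, Prod.smul_snd, hw1.smulRight, hw2.smulLeft, hw2.smulRight]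
    ring
  · intro x
    simp [tomega, hw1.alt]
  · rintro ⟨x, x'⟩ h
    have hx : x = 0 := hw2.nondeg x fun y => by
      simpa [tomega, hw1.zero_right, hw2.zero_left] using h (0, y)
    subst hx
    have hx' : x' = 0 := hw2.nondeg x' fun y => by
      rw [hw2.neg_swap]
      simpa [tomega, hw1.zero_left, hw2.zero_left] using h (y, 0)
    rw [hx', Prod.mk_zero_zero]
  · rintro ⟨a, a'⟩ ⟨b, b'⟩ ⟨c, c'⟩
    have h := hw1.cocycle a b c
    have hc := hw2.cocycle a b c'
    have ha := hw2.cocycle a' b c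
    have hb := hw2.cocycle a b' c
    simp only [tomega, tbr, hw2.addRight] at h ha hb hc ⊢
    rw [hw2.neg_swap c ⁅a, b'⁆, hw2.neg_swap c ⁅a', b⁆, hw2.neg_swap a ⁅b, c'⁆,
      hw2.neg_swap a ⁅b', c⁆, hw2.neg_swap b ⁅c, a'⁆, hw2.neg_swap b ⁅c', a⁆]
    linarith
end
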